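/- In the symmetric space decomposition so(2,n) = H ⊕ Q with H ≅ so(1,n), every nilpotent element E of Q satisfies ad(E)^3 = 0. -/

import Mathlib

open Matrix

namespace AdSNil

section Skew

attribute [local instance] LieRing.ofAssociativeRing

variable {ι : Type*} [Fintype ι] [DecidableEq ι]

/-- The map `A ↦ P A R` on matrices. -/
noncomputable def sand (P R : Matrix ι ι ℝ) : Matrix ι ι ℝ →ₗ[ℝ] Matrix ι ι ℝ where
  toFun A := P * A * R
  map_add' := by intros; simp [mul_add, add_mul]
  map_smul' := by intros; simp

/-- The map `A ↦ P Aᵀ R` on matrices. -/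
noncomputable def sandT (P R : Matrix ι ι ℝ) : Matrix ι ι ℝ →ₗ[ℝ] Matrix ι ι ℝ where
  toFun A := P * Aᵀ * R
  map_add' := by intros; simp [mul_add, add_mul]
  map_smul' := by intros; simp

lemma trace_eq_sum (f : Matrix ι ι ℝ →ₗ[ℝ] Matrix ι ι ℝ) :
    LinearMap.trace ℝ _ f = ∑ i, ∑ j, f (Matrix.single i j 1) i j := by
  rw [LinearMap.trace_eq_matrix_trace ℝ (Matrix.stdBasis ℝ ι ι), Matrix.trace,
    Fintype.sum_prod_type]
  refine Finset.sum_congr rfl fun i _ => Finset.sum_congr rfl fun j _ => ?_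
  simp only [Matrix.diag_apply, LinearMap.toMatrix_apply, Matrix.stdBasis_eq_single]
  rfl

lemma trace_sand (P R : Matrix ι ι ℝ) :
    LinearMap.trace ℝ _ (sand P R) = P.trace * R.trace := by
  rw [trace_eq_sum, Matrix.trace, Matrix.trace, Finset.sum_mul_sum]
  refine Finset.sum_congr rfl fun i _ => Finset.sum_congr rfl fun j _ => ?_
  simp [sand, Matrix.mul_apply, Matrix.single_apply, ite_and, Finset.sum_ite_eq]

lemma trace_sandT (P R : Matrix ι ι ℝ) :
    LinearMap.trace ℝ _ (sandT P R) = (P * Rᵀ).trace := by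
  rw [trace_eq_sum, Matrix.trace]
  refine Finset.sum_congr rfl fun i _ => ?_
  rw [Matrix.diag_apply, Matrix.mul_apply]
  refine Finset.sum_congr rfl fun j _ => ?_
  simp [sandT, Matrix.mul_apply, Matrix.single_apply, ite_and, Finset.sum_ite_eq]

/-- Adjoint with respect to `J`. -/
def adj (J A : Matrix ι ι ℝ) : Matrix ι ι ℝ := J * Aᵀ * J

lemma mem_iff {J : Matrix ι ι ℝ} (hJ2 : J * J = 1) (A : Matrix ι ι ℝ) :
    A ∈ skewAdjointMatricesLieSubalgebra J ↔ adj J A = -A := by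
  rw [mem_skewAdjointMatricesLieSubalgebra, mem_skewAdjointMatricesSubmodule,
    Matrix.IsSkewAdjoint, Matrix.IsAdjointPair, adj]
  constructor
  · intro h
    rw [mul_assoc, h, ← mul_assoc, hJ2, one_mul]
  · intro h
    rw [← h, ← mul_assoc, ← mul_assoc, hJ2, one_mul]

lemma adj_adj {J : Matrix ι ι ℝ} (hJ : Jᵀ = J) (hJ2 : J * J = 1) (A : Matrix ι ι ℝ) :
    adj J (adj J A) = A := by
  simp only [adj, Matrix.transpose_mul, hJ, Matrix.transpose_transpose]
  rw [show J * (J * (A * J)) * J = (J * J) * A * (J * J) by simp only [mul_assoc], hJ2]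
  simp

lemma adj_mul {J : Matrix ι ι ℝ} (hJ2 : J * J = 1) (A B : Matrix ι ι ℝ) :
    adj J (A * B) = adj J B * adj J A := by
  simp only [adj, Matrix.transpose_mul]
  rw [show J * Bᵀ * J * (J * Aᵀ * J) = J * Bᵀ * (J * J) * Aᵀ * J by simp only [mul_assoc], hJ2]
  simp [mul_assoc]

lemma trace_adj {J : Matrix ι ι ℝ} (hJ2 : J * J = 1) (A : Matrix ι ι ℝ) :
    (adj J A).trace = A.trace := by
  rw [adj, Matrix.trace_mul_comm, ← mul_assoc, hJ2, one_mul, Matrix.trace_transpose]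

lemma sub_adj_mem {J : Matrix ι ι ℝ} (hJ : Jᵀ = J) (hJ2 : J * J = 1) (A : Matrix ι ι ℝ) :
    A - adj J A ∈ skewAdjointMatricesLieSubalgebra J := by
  rw [mem_iff hJ2]
  have h := adj_adj hJ hJ2 A
  have : adj J (A - adj J A) = adj J A - adj J (adj J A) := by
    simp [adj, mul_sub, sub_mul]
  rw [this, h]; abel

lemma trace_skew {J : Matrix ι ι ℝ} (hJ2 : J * J = 1) {A : Matrix ι ι ℝ}
    (hA : adj J A = -A) : A.trace = 0 := by
  have := trace_adj hJ2 A
  rw [hA, Matrix.trace_neg] at this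
  linarith

/-- The projection of all matrices on the skew-adjoint ones. -/
noncomputable def proj (J : Matrix ι ι ℝ) : Matrix ι ι ℝ →ₗ[ℝ] Matrix ι ι ℝ :=
  (1 / 2 : ℝ) • (sand 1 1 - sandT J J)

lemma proj_apply (J A : Matrix ι ι ℝ) : proj J A = (1 / 2 : ℝ) • (A - adj J A) := by
  simp [proj, sand, sandT, adj]

lemma proj_isProj {J : Matrix ι ι ℝ} (hJ : Jᵀ = J) (hJ2 : J * J = 1) :
    LinearMap.IsProj (skewAdjointMatricesLieSubalgebra J).toSubmodule (proj J) := by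
  constructor
  · intro A
    rw [proj_apply]
    exact Submodule.smul_mem _ _ (sub_adj_mem hJ hJ2 A)
  · intro A hA
    have := (mem_iff hJ2 A).1 hA
    rw [proj_apply, this, sub_neg_eq_add, ← two_smul ℝ A, smul_smul]
    norm_num

lemma finrank_skew {J : Matrix ι ι ℝ} (hJ : Jᵀ = J) (hJ2 : J * J = 1) :
    2 * Module.finrank ℝ (skewAdjointMatricesLieSubalgebra J) + Fintype.card ι
      = Fintype.card ι * Fintype.card ι := by
  have h := (proj_isProj hJ hJ2).trace
  rw [proj, map_smul, map_sub, trace_sand, trace_sandT, hJ, hJ2, Matrix.trace_one] at h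
  have h' : (2 : ℝ) * (Module.finrank ℝ (skewAdjointMatricesLieSubalgebra J) : ℝ)
      + (Fintype.card ι : ℝ) = (Fintype.card ι : ℝ) * (Fintype.card ι : ℝ) := by
    have h2 : (Module.finrank ℝ (skewAdjointMatricesLieSubalgebra J) : ℝ)
      = (1 / 2 : ℝ) • ((Fintype.card ι : ℝ) * (Fintype.card ι : ℝ) - (Fintype.card ι : ℝ)) :=
      h.symm
    rw [h2, smul_eq_mul]; ring
  exact_mod_cast h'

lemma killing_skew {J : Matrix ι ι ℝ} (hJ : Jᵀ = J) (hJ2 : J * J = 1)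
    (X Y : skewAdjointMatricesLieSubalgebra J) :
    killingForm ℝ _ X Y = ((Fintype.card ι : ℝ) - 2) * ((X : Matrix ι ι ℝ) * Y).trace := by
  have hX := (mem_iff hJ2 _).1 X.2
  have hY := (mem_iff hJ2 _).1 Y.2
  set x : Matrix ι ι ℝ := X.1
  set y : Matrix ι ι ℝ := Y.1
  let S := (skewAdjointMatricesLieSubalgebra J).toSubmodule
  let g : Matrix ι ι ℝ →ₗ[ℝ] skewAdjointMatricesLieSubalgebra J :=
    LinearMap.codRestrict S (proj J) (proj_isProj hJ hJ2).map_mem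
  have hg : g ∘ₗ S.subtype = LinearMap.id := by
    ext1 A
    apply Subtype.ext
    exact (proj_isProj hJ hJ2).map_id A.1 A.2
  let Φ := LieAlgebra.ad ℝ _ X ∘ₗ LieAlgebra.ad ℝ _ Y
  have h1 : LinearMap.trace ℝ _ Φ = LinearMap.trace ℝ _ (S.subtype ∘ₗ (Φ ∘ₗ g)) := by
    have h0 := LinearMap.trace_comp_comm' (R := ℝ) S.subtype (Φ ∘ₗ g)
    rw [LinearMap.comp_assoc, hg, LinearMap.comp_id] at h0
    exact h0
  have h2 : S.subtype ∘ₗ (Φ ∘ₗ g) = (1 / 2 : ℝ) • (sand (x * y) 1 - sand x y - sand y x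
      + sand 1 (y * x) - sandT (x * y * J) J + sandT (x * J) (J * y) + sandT (y * J) (J * x)
      - sandT J (J * (y * x))) := by
    apply LinearMap.ext
    intro A
    have : (S.subtype ∘ₗ (Φ ∘ₗ g)) A
      = x * (y * proj J A - proj J A * y) - (y * proj J A - proj J A * y) * x := rfl
    rw [this, proj_apply]
    simp only [LinearMap.smul_apply, LinearMap.add_apply, LinearMap.sub_apply, sand, sandT,
      LinearMap.coe_mk, AddHom.coe_mk, adj, Matrix.mul_smul, Matrix.smul_mul, ← smul_sub,
      mul_sub, sub_mul, mul_assoc, mul_one, one_mul]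
    congr 1
    abel
  rw [killingForm_apply_apply]
  change LinearMap.trace ℝ _ Φ = _
  rw [h1, h2]
  have e0 : ∀ Z : Matrix ι ι ℝ, J * (J * Z) = Z := fun Z => by rw [← mul_assoc, hJ2, one_mul]
  have hx' : J * (xᵀ * J) = -x := by rw [← hX, adj, mul_assoc]
  have hy' : J * (yᵀ * J) = -y := by rw [← hY, adj, mul_assoc]
  simp only [map_smul, map_add, map_sub, trace_sand, trace_sandT, Matrix.transpose_mul, hJ,
    mul_assoc, hx', hy', hJ2, Matrix.trace_one, trace_skew hJ2 hX, mul_one, mul_neg,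
    Matrix.trace_neg, smul_eq_mul]
  have h3 : (J * (xᵀ * (yᵀ * J))).trace = (x * y).trace := by
    have : J * (xᵀ * (yᵀ * J)) = adj J (y * x) := by simp [adj, mul_assoc]
    rw [this, trace_adj hJ2, Matrix.trace_mul_comm]
  rw [h3, Matrix.trace_mul_comm y x]
  ring

lemma eq_zero_of_trace {κ : Type*} [Fintype κ] {X : Matrix κ κ ℝ} (h : ∀ Z : Matrix κ κ ℝ, (X * Z).trace = 0) :
    X = 0 := by
  have := h Xᵀ
  rw [← Matrix.conjTranspose_eq_transpose_of_trivial] at this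
  exact Matrix.trace_mul_conjTranspose_self_eq_zero_iff.1 this

lemma isKilling_skew {J : Matrix ι ι ℝ} (hJ : Jᵀ = J) (hJ2 : J * J = 1)
    (hN : 3 ≤ Fintype.card ι) :
    LieAlgebra.IsKilling ℝ (skewAdjointMatricesLieSubalgebra J) := by
  constructor
  rw [eq_bot_iff]
  intro X hX
  rw [LieIdeal.mem_killingCompl] at hX
  rw [LieSubmodule.mem_bot]
  apply Subtype.ext
  have hXs := (mem_iff hJ2 _).1 X.2
  apply eq_zero_of_trace
  intro M
  have h := hX ⟨_, sub_adj_mem hJ hJ2 M⟩ trivial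
  rw [LieModule.traceForm_comm, killing_skew hJ hJ2] at h
  have hN' : (3 : ℝ) ≤ Fintype.card ι := by exact_mod_cast hN
  have h2 := (mul_eq_zero.1 h).resolve_left (by linarith)
  have h3 : ((X : Matrix ι ι ℝ) * adj J M).trace = -((X : Matrix ι ι ℝ) * M).trace := by
    rw [← trace_adj hJ2, adj_mul hJ2, adj_adj hJ hJ2, hXs, mul_neg, Matrix.trace_neg,
      Matrix.trace_mul_comm]
  simp only [mul_sub, Matrix.trace_sub, h3] at h2
  linarith


lemma ideal_skew {J : Matrix ι ι ℝ} (hJ : Jᵀ = J) (hJ2 : J * J = 1)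
    (hN : 3 ≤ Fintype.card ι) (hN4 : Fintype.card ι ≠ 4)
    (I : LieIdeal ℝ (skewAdjointMatricesLieSubalgebra J)) : I = ⊥ ∨ I = ⊤ := by
  have := isKilling_skew hJ hJ2 hN
  have hc := LieIdeal.isCompl_killingCompl I
  set C := I.killingCompl
  have hN' : (3 : ℝ) ≤ Fintype.card ι := by exact_mod_cast hN
  have hcard4 : (Fintype.card ι : ℝ) - 4 ≠ 0 := by
    rw [sub_ne_zero]; exact_mod_cast hN4
  -- elements of `I` and `C` commute
  have hcomm : ∀ X ∈ I, ∀ Y ∈ C, (X : Matrix ι ι ℝ) * Y = (Y : Matrix ι ι ℝ) * X := by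
    intro X hX Y hY
    have h1 : ⁅X, Y⁆ ∈ I ⊓ C :=
      ⟨lie_mem_left ℝ _ I X Y hX, lie_mem_right ℝ _ C X Y hY⟩
    rw [hc.inf_eq_bot, LieSubmodule.mem_bot] at h1
    have h2 := congrArg Subtype.val h1
    exact sub_eq_zero.1 h2
  -- the products vanish
  have hprod : ∀ X ∈ I, ∀ Y ∈ C, (X : Matrix ι ι ℝ) * Y = 0 := by
    intro X hX Y hY
    have hXs := (mem_iff hJ2 _).1 X.2
    have hYs := (mem_iff hJ2 _).1 Y.2
    have hXY := hcomm X hX Y hY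
    have hA : ∀ A : skewAdjointMatricesLieSubalgebra J,
        (X.1 * A.1 - A.1 * X.1) * Y.1 = Y.1 * (X.1 * A.1 - A.1 * X.1) := fun A =>
      hcomm ⁅X, A⁆ (lie_mem_left ℝ _ I X A hX) Y hY
    obtain ⟨x, hx⟩ := X
    obtain ⟨y, hy⟩ := Y
    simp only at hXs hYs hXY hA ⊢
    have e0 : ∀ Z : Matrix ι ι ℝ, J * (J * Z) = Z := fun Z => by rw [← mul_assoc, hJ2, one_mul]
    have hx' : xᵀ * J = -(J * x) := by
      have := congrArg (fun Z => J * Z) hXs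
      simpa [adj, ← mul_assoc, hJ2] using this
    have hy' : yᵀ * J = -(J * y) := by
      have := congrArg (fun Z => J * Z) hYs
      simpa [adj, ← mul_assoc, hJ2] using this
    have hP : ∀ Z : Matrix ι ι ℝ, (x * y * adj J Z).trace = (x * y * Z).trace := by
      intro Z
      rw [← trace_adj hJ2, adj_mul hJ2, adj_adj hJ hJ2, adj_mul hJ2, hXs, hYs,
        Matrix.trace_mul_comm, neg_mul_neg, ← hXY]
    have key : ∀ Z : Matrix ι ι ℝ, 4 * (x * y * Z).trace
        = Fintype.card ι * (x * y * Z).trace + (x * y).trace * Z.trace := by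
      intro Z
      have hlin : sand x (y * Z) + sand y (x * Z) - sandT (x * J) (J * y * Z)
          - sandT (y * J) (J * x * Z)
          = sand 1 (x * y * Z) + sand (x * y) Z - sandT J (J * (x * y) * Z)
            - sandT (x * y * J) (J * Z) := by
        apply LinearMap.ext
        intro M
        have h := hA ⟨_, sub_adj_mem hJ hJ2 M⟩
        simp only [adj] at h
        have h' := congrArg (fun W => W * Z) h
        simp only [LinearMap.add_apply, LinearMap.sub_apply, sand, sandT,
          LinearMap.coe_mk, AddHom.coe_mk, one_mul]
        have hXYl : ∀ W, y * (x * W) = x * (y * W) := fun W => by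
          rw [← mul_assoc, ← hXY, mul_assoc]
        simp only [mul_sub, sub_mul, mul_assoc, hXYl] at h' ⊢
        rw [← sub_eq_zero] at h' ⊢
        rw [← h']
        abel
      have h := congrArg (LinearMap.trace ℝ _) hlin
      simp only [map_add, map_sub, trace_sand, trace_sandT, trace_skew hJ2 hXs,
        trace_skew hJ2 hYs, Matrix.transpose_mul, hJ, Matrix.trace_one] at h
      have t1 : (x * J * (Zᵀ * (yᵀ * J))).trace = -(x * y * Z).trace := by
        rw [hy', ← hP Z, mul_neg, mul_neg, Matrix.trace_neg, hXY, adj, Matrix.trace_mul_comm,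
          Matrix.trace_mul_comm (y * x)]
        have := Matrix.trace_mul_comm (Zᵀ * (J * y)) (x * J)
        rw [this, Matrix.trace_mul_comm (J * Zᵀ * J)]
        rw [show y * x * (J * Zᵀ * J) = y * (x * J * Zᵀ * J) by simp only [mul_assoc],
          Matrix.trace_mul_comm y]
        simp only [mul_assoc]
      have t2 : (y * J * (Zᵀ * (xᵀ * J))).trace = -(x * y * Z).trace := by
        rw [hx', ← hP Z, mul_neg, mul_neg, Matrix.trace_neg, adj]
        rw [show x * y * (J * Zᵀ * J) = x * (y * J * Zᵀ * J) by simp only [mul_assoc],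
          Matrix.trace_mul_comm x]
        simp only [mul_assoc]
      have t3 : (J * (Zᵀ * (yᵀ * xᵀ * J))).trace = (x * y * Z).trace := by
        have e : yᵀ * xᵀ * J = J * (x * y) := by
          rw [mul_assoc, hx', mul_neg, ← mul_assoc, hy', neg_mul, neg_neg, hXY, mul_assoc]
        rw [e, ← hP Z, Matrix.trace_mul_comm (x * y), adj]
        simp only [mul_assoc]
      have t4 : (x * y * J * (Zᵀ * J)).trace = (x * y * Z).trace := by
        rw [← hP Z, adj]; simp only [mul_assoc]
      rw [t1, t2, t3, t4] at h
      linarith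
    have h1 := key 1
    simp only [mul_one, Matrix.trace_one] at h1
    have h2 : (x * y).trace = 0 := by
      have : (2 * (Fintype.card ι : ℝ) - 4) * (x * y).trace = 0 := by linarith
      exact (mul_eq_zero.1 this).resolve_left (by linarith)
    apply eq_zero_of_trace
    intro Z
    have h3 := key Z
    rw [h2, zero_mul, add_zero] at h3
    have : ((Fintype.card ι : ℝ) - 4) * (x * y * Z).trace = 0 := by linarith
    exact (mul_eq_zero.1 this).resolve_left hcard4
  -- sandwiches vanish
  have hsand : ∀ X ∈ I, ∀ Y ∈ C, ∀ T : skewAdjointMatricesLieSubalgebra J,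
      (X : Matrix ι ι ℝ) * T * Y = 0 := by
    intro X hX Y hY T
    have hT : T ∈ I ⊔ C := by rw [hc.sup_eq_top]; trivial
    obtain ⟨A, hA, B, hB, rfl⟩ := (LieSubmodule.mem_sup _ _ _).1 hT
    have : ((A + B : skewAdjointMatricesLieSubalgebra J) : Matrix ι ι ℝ) = A.1 + B.1 := rfl
    rw [this, mul_add, add_mul, mul_assoc, hprod A hA Y hY, hprod X hX B hB]
    simp
  by_cases hI : I = ⊥
  · exact Or.inl hI
  right
  suffices hC : C = ⊥ by
    have := hc.sup_eq_top
    rwa [hC, sup_bot_eq] at this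
  obtain ⟨X, hX, hX0⟩ : ∃ X ∈ I, X ≠ 0 := by
    by_contra! hcon
    exact hI ((LieSubmodule.eq_bot_iff _).2 hcon)
  have hX0' : (X : Matrix ι ι ℝ) ≠ 0 := fun h => hX0 (Subtype.ext h)
  obtain ⟨a, i, hai⟩ : ∃ a i, (X : Matrix ι ι ℝ) a i ≠ 0 := by
    by_contra! hcon
    exact hX0' (Matrix.ext hcon)
  rw [eq_bot_iff]
  intro Y hY
  rw [LieSubmodule.mem_bot]
  apply Subtype.ext
  have hYs := (mem_iff hJ2 _).1 Y.2
  have hskew : (J * Y.1)ᵀ = -(J * Y.1) := by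
    have := congrArg (fun Z => J * Z) hYs
    rw [Matrix.transpose_mul, hJ]
    simpa [adj, ← mul_assoc, hJ2] using this
  set W := J * Y.1 with hW
  have hsk : ∀ j b, W j b = - W b j := fun j b => by
    have := congrFun (congrFun hskew b) j
    simpa using this
  have hrel : ∀ j b, X.1 a i * W j b = X.1 a j * W i b := by
    intro j b
    have hmem : (Matrix.single i j 1 - Matrix.single j i 1) * J
        ∈ skewAdjointMatricesLieSubalgebra J := by
      rw [mem_iff hJ2, adj, Matrix.transpose_mul, hJ, ← mul_assoc, hJ2, one_mul,
        Matrix.transpose_sub, Matrix.transpose_single, Matrix.transpose_single, ← neg_mul, neg_sub]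
    have h := hsand X hX Y hY ⟨_, hmem⟩
    have h' := congrFun (congrFun h a) b
    have e : X.1 * ((Matrix.single i j 1 - Matrix.single j i 1) * J) * Y.1
        = X.1 * Matrix.single i j 1 * W - X.1 * Matrix.single j i 1 * W := by
      rw [hW]; simp only [mul_sub, sub_mul, mul_assoc]
    simp only at h'
    rw [e] at h'
    simp [Matrix.mul_apply, Matrix.single_apply, ite_and, Finset.sum_ite_eq] at h'
    linarith
  have hWi : ∀ b, W i b = 0 := by
    intro b
    have h1 := hrel b i
    have h2 : W i i = 0 := by have := hsk i i; linarith
    rw [h2, mul_zero] at h1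
    rw [hsk, (mul_eq_zero.1 h1).resolve_left hai, neg_zero]
  have hW0 : W = 0 := by
    ext j b
    have h1 := hrel j b
    rw [hWi, mul_zero] at h1
    exact (mul_eq_zero.1 h1).resolve_left hai
  have : Y.1 = J * W := by rw [hW, ← mul_assoc, hJ2, one_mul]
  rw [this, hW0, mul_zero]; rfl

end Skew

lemma indef_transpose (p q : Type*) [DecidableEq p] [DecidableEq q] :
    (LieAlgebra.Orthogonal.indefiniteDiagonal p q ℝ)ᵀ
      = LieAlgebra.Orthogonal.indefiniteDiagonal p q ℝ := by
  simp [LieAlgebra.Orthogonal.indefiniteDiagonal]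

lemma indef_sq (p q : Type*) [DecidableEq p] [DecidableEq q] [Fintype p] [Fintype q] :
    LieAlgebra.Orthogonal.indefiniteDiagonal p q ℝ
      * LieAlgebra.Orthogonal.indefiniteDiagonal p q ℝ = 1 := by
  rw [LieAlgebra.Orthogonal.indefiniteDiagonal, Matrix.diagonal_mul_diagonal, ← Matrix.diagonal_one]
  congr 1
  ext i
  cases i <;> simp

section Main

variable {L : Type*} [LieRing L] [LieAlgebra ℝ L]

lemma main_aux [FiniteDimensional ℝ L] [LieAlgebra.IsKilling ℝ L]
    (σ : L ≃ₗ⁅ℝ⁆ L) (hσ : Function.Involutive σ) (H Q : Submodule ℝ L)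
    (hH : ∀ x, x ∈ H ↔ σ x = x) (hQ : ∀ x, x ∈ Q ↔ σ x = -x)
    (hdim : 2 * Module.finrank ℝ H + Module.finrank ℝ Q
      = Module.finrank ℝ Q * Module.finrank ℝ Q)
    (hfaith : ∀ T ∈ H, (∀ q ∈ Q, ⁅T, q⁆ = 0) → T = 0)
    (E : L) (hE : E ∈ Q) (hnil : IsNilpotent (LieAlgebra.ad ℝ L E)) :
    (LieAlgebra.ad ℝ L E) ^ 3 = 0 := by
  set κ := killingForm ℝ L with hκ
  have hsymm : ∀ x y, κ x y = κ y x := LieModule.traceForm_comm ℝ L L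
  have hinv : ∀ x y z, κ ⁅x, y⁆ z = - κ y ⁅x, z⁆ := LieModule.traceForm_apply_lie_apply' ℝ L L
  have hinvσ : ∀ x y, κ (σ x) (σ y) = κ x y := LieAlgebra.killingForm_of_equiv_apply σ
  have horth : ∀ x ∈ H, ∀ y ∈ Q, κ x y = 0 := by
    intro x hx y hy
    have := hinvσ x y
    rw [(hH x).1 hx, (hQ y).1 hy, map_neg] at this
    linarith
  have hdec : ∀ x : L, ∃ h ∈ H, ∃ q ∈ Q, x = h + q := by
    intro x
    refine ⟨(1 / 2 : ℝ) • (x + σ x), ?_, (1 / 2 : ℝ) • (x - σ x), ?_, ?_⟩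
    · rw [hH, map_smul, map_add, hσ x, add_comm]
    · rw [hQ, map_smul, map_sub, hσ x, ← smul_neg, neg_sub]
    · rw [← smul_add, add_add_sub_cancel, ← two_smul ℝ x, smul_smul]; norm_num
  have hnd : ∀ x, (∀ y, κ x y = 0) → x = 0 := by
    intro x hx
    have : x ∈ LinearMap.ker κ := LinearMap.ext hx
    rw [LieAlgebra.IsKilling.ker_killingForm_eq_bot] at this
    exact this
  have hndQ : ∀ x ∈ Q, (∀ y ∈ Q, κ x y = 0) → x = 0 := by
    intro x hx h
    apply hnd
    intro y
    obtain ⟨a, ha, q, hq, rfl⟩ := hdec y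
    rw [map_add, h q hq, hsymm, horth a ha x hx, add_zero]
  have hHQ : ∀ x ∈ H, ∀ y ∈ Q, ⁅x, y⁆ ∈ Q := by
    intro x hx y hy
    rw [hQ, LieEquiv.map_lie, (hH x).1 hx, (hQ y).1 hy, lie_neg]
  have hQQ : ∀ x ∈ Q, ∀ y ∈ Q, ⁅x, y⁆ ∈ H := by
    intro x hx y hy
    rw [hH, LieEquiv.map_lie, (hQ x).1 hx, (hQ y).1 hy, lie_neg, neg_lie, neg_neg]
  have hQH : ∀ x ∈ Q, ∀ y ∈ H, ⁅x, y⁆ ∈ Q := by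
    intro x hx y hy
    rw [← lie_skew]
    exact Q.neg_mem (hHQ y hy x hx)
  -- every skew endomorphism of `Q` comes from `H`
  have hsurj : ∀ S : L →ₗ[ℝ] L, (∀ x ∈ Q, S x ∈ Q) → (∀ x ∈ Q, ∀ y ∈ Q, κ (S x) y = - κ x (S y)) →
      ∃ T ∈ H, ∀ x ∈ Q, ⁅T, x⁆ = S x := by
    intro S hSQ hS
    let v := Module.finBasis ℝ Q
    let M : Type := Matrix (Fin (Module.finrank ℝ Q)) (Fin (Module.finrank ℝ Q)) ℝ
    let sk := skewAdjointMatricesSubmodule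
      (1 : Matrix (Fin (Module.finrank ℝ Q)) (Fin (Module.finrank ℝ Q)) ℝ)
    have hsk : ∀ A, A ∈ sk ↔ Aᵀ = -A := by
      intro A
      rw [mem_skewAdjointMatricesSubmodule, Matrix.IsSkewAdjoint, Matrix.IsAdjointPair,
        mul_one, one_mul]
    have hfin : Module.finrank ℝ H = Module.finrank ℝ sk := by
      have h := finrank_skew (J := (1 : Matrix (Fin (Module.finrank ℝ Q))
        (Fin (Module.finrank ℝ Q)) ℝ)) Matrix.transpose_one (one_mul 1)
      rw [Fintype.card_fin] at h
      have h' : 2 * Module.finrank ℝ sk + Module.finrank ℝ Q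
        = Module.finrank ℝ Q * Module.finrank ℝ Q := h
      omega
    let Φ0 : H →ₗ[ℝ] Matrix (Fin (Module.finrank ℝ Q)) (Fin (Module.finrank ℝ Q)) ℝ :=
      { toFun := fun T => Matrix.of fun i j => κ ⁅(T : L), (v i : L)⁆ (v j : L)
        map_add' := by intro a b; ext i j; simp [add_lie]
        map_smul' := by intro c b; ext i j; simp }
    have hΦ0 : ∀ T, Φ0 T ∈ sk := by
      intro T
      rw [hsk]
      ext i j
      change κ ⁅(T : L), (v j : L)⁆ (v i : L) = -κ ⁅(T : L), (v i : L)⁆ (v j : L)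
      rw [hinv, hsymm]
    let Φ : H →ₗ[ℝ] sk := LinearMap.codRestrict sk Φ0 hΦ0
    -- bilinear extension from the basis
    have hext : ∀ F G : L →ₗ[ℝ] L, (∀ x ∈ Q, F x ∈ Q) → (∀ x ∈ Q, G x ∈ Q) →
        (∀ i j, κ (F (v i)) (v j) = κ (G (v i)) (v j)) → ∀ x ∈ Q, F x = G x := by
      intro F G hF hG h
      have h1 : ∀ i, F (v i) = G (v i) := by
        intro i
        rw [← sub_eq_zero]
        apply hndQ _ (Q.sub_mem (hF _ (v i).2) (hG _ (v i).2))
        have h2 : (κ (F (v i) - G (v i))) ∘ₗ Q.subtype = 0 := by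
          apply v.ext
          intro j
          simp [h i j]
        intro y hy
        exact LinearMap.congr_fun h2 ⟨y, hy⟩
      have h3 : F ∘ₗ Q.subtype = G ∘ₗ Q.subtype := v.ext h1
      intro x hx
      exact LinearMap.congr_fun h3 ⟨x, hx⟩
    have hinj : Function.Injective Φ := by
      rw [← LinearMap.ker_eq_bot, LinearMap.ker_eq_bot']
      intro T hT
      apply Subtype.ext
      apply hfaith T.1 T.2
      have hT0 : Φ0 T = 0 := congrArg Subtype.val hT
      exact hext (LieAlgebra.ad ℝ L T.1) 0 (fun x hx => hHQ _ T.2 x hx) (fun x _ => Q.zero_mem)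
        (fun i j => by
          have := congrFun (congrFun hT0 i) j
          rw [LinearMap.zero_apply, map_zero, LinearMap.zero_apply]
          exact this)
    have hsur := (LinearMap.injective_iff_surjective_of_finrank_eq_finrank hfin).1 hinj
    have hSm : (Matrix.of fun i j => κ (S (v i)) (v j)) ∈ sk := by
      rw [hsk]
      ext i j
      change κ (S (v j)) (v i) = -κ (S (v i)) (v j)
      rw [hS _ (v j).2 _ (v i).2, hsymm]
    obtain ⟨T, hT⟩ := hsur ⟨_, hSm⟩
    have hT0 : Φ0 T = Matrix.of fun i j => κ (S (v i)) (v j) := congrArg Subtype.val hT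
    refine ⟨T.1, T.2, ?_⟩
    exact hext (LieAlgebra.ad ℝ L T.1) S (fun x hx => hHQ _ T.2 x hx) hSQ
      (fun i j => congrFun (congrFun hT0 i) j)
  by_cases hE0 : E = 0
  · rw [hE0, map_zero]; simp
  have hEE : κ E E = 0 := by
    rw [hκ, killingForm_apply_apply]
    have h2 : IsNilpotent (LieAlgebra.ad ℝ L E ∘ₗ LieAlgebra.ad ℝ L E) := by
      have := hnil.pow_of_pos (n := 2) (by norm_num)
      rwa [pow_two] at this
    exact (LinearMap.isNilpotent_trace_of_isNilpotent h2).eq_zero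
  obtain ⟨z, hz, hEz⟩ : ∃ z ∈ Q, κ E z = 1 := by
    by_contra! hcon
    apply hE0
    apply hndQ E hE
    intro y hy
    by_contra hne
    apply hcon ((κ E y)⁻¹ • y) (Q.smul_mem _ hy)
    rw [map_smul, smul_eq_mul, inv_mul_cancel₀ hne]
  -- the operator `A = ad(E)²`
  set A : L → L := fun x => ⁅E, ⁅E, x⁆⁆ with hA
  have hAQ : ∀ x ∈ Q, A x ∈ Q := fun x hx => hQH _ hE _ (hQQ _ hE _ hx)
  have hAsymm : ∀ x y, κ (A x) y = κ x (A y) := by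
    intro x y
    simp only [hA]
    rw [hinv, hinv, neg_neg]
  have hAE : A E = 0 := by simp [hA]
  have hstep : ∀ w ∈ Q, κ E w = 0 → ∀ x ∈ Q,
      κ w (A x) • E = - (κ E x • A w) := by
    intro w hw hEw x hx
    let S : L →ₗ[ℝ] L := (κ w).smulRight E - (κ E).smulRight w
    have hSx : ∀ x, S x = κ w x • E - κ E x • w := fun x => by simp [S]
    obtain ⟨T, hT, hTS⟩ := hsurj S
      (fun x _ => by rw [hSx]; exact Q.sub_mem (Q.smul_mem _ hE) (Q.smul_mem _ hw))
      (fun x _ y _ => by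
        rw [hSx, hSx]
        simp only [map_sub, map_smul, LinearMap.sub_apply, LinearMap.smul_apply, smul_eq_mul]
        rw [hsymm x E, hsymm x w]; ring)
    have hTE : ⁅T, E⁆ = 0 := by
      rw [hTS E hE, hSx, hEE, hsymm w E, hEw]; simp
    have hcomm : ⁅T, A x⁆ = A ⁅T, x⁆ := by
      simp only [hA]
      rw [leibniz_lie, hTE, zero_lie, zero_add, leibniz_lie T E x, hTE, zero_lie, zero_add]
    rw [hTS _ (hAQ x hx), hTS x hx, hSx, hSx] at hcomm
    have hEA : κ E (A x) = 0 := by rw [← hAsymm, hAE, map_zero, LinearMap.zero_apply]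
    rw [hEA, zero_smul, sub_zero] at hcomm
    have hlin : A (κ w x • E - κ E x • w) = κ w x • A E - κ E x • A w := by
      simp [hA]
    rw [hcomm, hlin, hAE, smul_zero, zero_sub]
  -- `A` vanishes on the orthogonal of `E`
  have hAw : ∀ w ∈ Q, κ E w = 0 → A w = 0 := by
    intro w hw hEw
    have h1 := hstep w hw hEw z hz
    rw [hEz, one_smul] at h1
    have h2 : κ (A w) z = κ w (A z) := hAsymm w z
    have h3 : A w = -(κ w (A z) • E) := by rw [h1, neg_neg]
    rw [h3, map_neg, map_smul, LinearMap.neg_apply, LinearMap.smul_apply, hEz, smul_eq_mul,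
      mul_one] at h2
    have h4 : κ w (A z) = 0 := by linarith
    rw [h3, h4, zero_smul, neg_zero]
  -- hence `A x` is a multiple of `E`
  have hAx : ∀ x ∈ Q, A x = κ E x • A z := by
    intro x hx
    have h := hAw (x - κ E x • z) (Q.sub_mem hx (Q.smul_mem _ hz))
      (by rw [map_sub, map_smul, hEz, smul_eq_mul, mul_one, sub_self])
    have hlin : A (x - κ E x • z) = A x - κ E x • A z := by simp [hA]
    rw [hlin, sub_eq_zero] at h
    exact h
  have hAz : A z = κ (A z) z • E := by
    rw [← sub_eq_zero]
    apply hndQ _ (Q.sub_mem (hAQ z hz) (Q.smul_mem _ hE))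
    intro y hy
    have h1 := hAx y hy
    rw [map_sub, map_smul, LinearMap.sub_apply, LinearMap.smul_apply, hAsymm z y, h1, map_smul,
      smul_eq_mul, smul_eq_mul, hsymm z (A z)]
    ring
  apply LinearMap.ext
  intro x
  have hcube : ((LieAlgebra.ad ℝ L E) ^ 3) x = ⁅E, ⁅E, ⁅E, x⁆⁆⁆ := rfl
  rw [hcube, LinearMap.zero_apply]
  obtain ⟨h, hh, q, hq, rfl⟩ := hdec x
  have p1 : ⁅E, ⁅E, ⁅E, h⁆⁆⁆ = 0 := by
    have h1 := hAx _ (hQH E hE h hh)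
    have h2 : κ E ⁅E, h⁆ = 0 := by
      have := hinv E E h
      rw [lie_self, map_zero, LinearMap.zero_apply] at this
      linarith
    rw [h2, zero_smul] at h1
    exact h1
  have p2 : ⁅E, ⁅E, ⁅E, q⁆⁆⁆ = 0 := by
    have h1 : ⁅E, ⁅E, q⁆⁆ = κ E q • A z := hAx q hq
    rw [h1, hAz, lie_smul, lie_smul, lie_self, smul_zero, smul_zero]
  rw [lie_add, lie_add, lie_add, p1, p2, add_zero]

/-- An ideal of a Lie algebra isomorphic to `so(p,q)` is trivial, if `p + q ≥ 3`, `p + q ≠ 4`. -/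
lemma ideal_of_equiv {p q : Type} [Fintype p] [Fintype q] [DecidableEq p] [DecidableEq q]
    (e : L ≃ₗ⁅ℝ⁆ ↥(LieAlgebra.Orthogonal.so' p q ℝ))
    (hN : 3 ≤ Fintype.card (p ⊕ q)) (hN4 : Fintype.card (p ⊕ q) ≠ 4)
    (I : LieIdeal ℝ L) : I = ⊥ ∨ I = ⊤ := by
  let I' : LieIdeal ℝ (LieAlgebra.Orthogonal.so' p q ℝ) := I.comap e.symm.toLieHom
  have hI' : ∀ y, y ∈ I' ↔ e.symm y ∈ I := fun y => LieIdeal.mem_comap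
  have hor : I' = ⊥ ∨ I' = ⊤ := ideal_skew (indef_transpose p q) (indef_sq p q) hN hN4 I'
  rcases hor with h | h
  · left
    rw [LieSubmodule.eq_bot_iff]
    intro x hx
    have : e x ∈ I' := by rw [hI']; simpa using hx
    rw [h, LieSubmodule.mem_bot] at this
    simpa using congrArg e.symm this
  · right
    rw [eq_top_iff]
    intro x _
    have : e x ∈ I' := by rw [h]; trivial
    rw [hI'] at this
    simpa using this

lemma finrank_of_equiv {p q : Type} [Fintype p] [Fintype q] [DecidableEq p] [DecidableEq q]
    (e : L ≃ₗ⁅ℝ⁆ ↥(LieAlgebra.Orthogonal.so' p q ℝ)) :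
    2 * Module.finrank ℝ L + Fintype.card (p ⊕ q)
      = Fintype.card (p ⊕ q) * Fintype.card (p ⊕ q) := by
  rw [e.toLinearEquiv.finrank_eq]
  exact finrank_skew (indef_transpose p q) (indef_sq p q)

end Main

end AdSNil

/-- In the symmetric space decomposition `so(2,n) = H ⊕ Q` with `H ≅ so(1,n)`,
every nilpotent element `E` of `Q` satisfies `ad(E)³ = 0`. -/
theorem ad_cube_eq_zero_of_nilpotent_in_Q
    (n : ℕ) {L : Type*} [LieRing L] [LieAlgebra ℝ L]
    -- `L` is (isomorphic to) `so(2,n)`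
    (hL : Nonempty (L ≃ₗ⁅ℝ⁆ ↥(LieAlgebra.Orthogonal.so' (Fin 2) (Fin n) ℝ)))
    -- the involution `σ` defining the symmetric pair, commuting with a Cartan involution `θ`
    (σ θ : L ≃ₗ⁅ℝ⁆ L) (hσ : Function.Involutive σ) (hθi : Function.Involutive θ)
    (hcomm : ∀ x, σ (θ x) = θ (σ x))
    -- `H` is the fixed-point algebra of `σ`, and is isomorphic to `so(1,n)`
    (H : LieSubalgebra ℝ L) (hH : ∀ x : L, x ∈ H ↔ σ x = x)
    (hHiso : Nonempty (H ≃ₗ⁅ℝ⁆ ↥(LieAlgebra.Orthogonal.so' (Fin 1) (Fin n) ℝ))) :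
    -- every nilpotent element of the (-1)-eigenspace `Q` of `σ` has `ad(E)³ = 0`
    ∀ E : L, σ E = -E → IsNilpotent (LieAlgebra.ad ℝ L E) →
      (LieAlgebra.ad ℝ L E) ^ 3 = 0 := by
  intro E hE hnil
  obtain ⟨e⟩ := hL
  obtain ⟨eH⟩ := hHiso
  have : FiniteDimensional ℝ L := Module.Finite.equiv e.toLinearEquiv.symm
  have dL := AdSNil.finrank_of_equiv e
  have dH := AdSNil.finrank_of_equiv eH
  simp only [Fintype.card_sum, Fintype.card_fin] at dL dH
  rcases Nat.lt_or_ge n 2 with hn | hn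
  · -- small cases: `dim L ≤ 3`
    have h3 : Module.finrank ℝ L ≤ 3 := by
      interval_cases n <;> omega
    have h0 : LieAlgebra.ad ℝ L E ^ Module.finrank ℝ L = 0 := by
      have h1 := IsNilpotent.charpoly_eq_X_pow_finrank hnil
      have h2 := LinearMap.aeval_self_charpoly (LieAlgebra.ad ℝ L E)
      rwa [h1, map_pow, Polynomial.aeval_X] at h2
    exact pow_eq_zero_of_le h3 h0
  have hK : LieAlgebra.IsKilling ℝ L := by
    have h := AdSNil.isKilling_skew (AdSNil.indef_transpose (Fin 2) (Fin n))
      (AdSNil.indef_sq (Fin 2) (Fin n))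
      (by simp only [Fintype.card_sum, Fintype.card_fin]; omega)
    have h' : LieAlgebra.IsKilling ℝ (LieAlgebra.Orthogonal.so' (Fin 2) (Fin n) ℝ) := h
    exact LieAlgebra.isKilling_of_equiv e.symm
  let Q : Submodule ℝ L := LinearMap.ker ((σ : L →ₗ[ℝ] L) + LinearMap.id)
  have hQ : ∀ x, x ∈ Q ↔ σ x = -x := by
    intro x
    rw [LinearMap.mem_ker, eq_neg_iff_add_eq_zero]
    rfl
  have hcompl : IsCompl H.toSubmodule Q := by
    constructor
    · rw [Submodule.disjoint_def]
      intro x hx hq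
      have h1 := (hH x).1 hx
      have h2 := (hQ x).1 hq
      rw [h1] at h2
      have h3 : (2 : ℝ) • x = 0 := by
        rw [two_smul]; nth_rewrite 1 [h2]; exact neg_add_cancel x
      exact (smul_eq_zero.1 h3).resolve_left two_ne_zero
    · rw [codisjoint_iff, eq_top_iff]
      intro x _
      rw [Submodule.mem_sup]
      refine ⟨(1 / 2 : ℝ) • (x + σ x), ?_, (1 / 2 : ℝ) • (x - σ x), ?_, ?_⟩
      · rw [LieSubalgebra.mem_toSubmodule, hH, map_smul, map_add, hσ x, add_comm]
      · rw [hQ, map_smul, map_sub, hσ x, ← smul_neg, neg_sub]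
      · rw [← smul_add, add_add_sub_cancel, ← two_smul ℝ x, smul_smul]; norm_num
  have hsum : Module.finrank ℝ H + Module.finrank ℝ Q = Module.finrank ℝ L :=
    Submodule.finrank_add_eq_of_isCompl hcompl
  have hfq : Module.finrank ℝ Q = n + 1 := by
    have h1 : (2 + n) * (2 + n) = (1 + n) * (1 + n) + 2 * n + 3 := by ring
    omega
  have hdec : ∀ x : L, ∃ h ∈ H, ∃ q ∈ Q, h + q = x := by
    intro x
    have hx : x ∈ H.toSubmodule ⊔ Q := by rw [hcompl.sup_eq_top]; trivial
    exact Submodule.mem_sup.1 hx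
  have hHQ : ∀ x ∈ H, ∀ y ∈ Q, ⁅x, y⁆ ∈ Q := by
    intro x hx y hy
    rw [hQ, LieEquiv.map_lie, (hH x).1 hx, (hQ y).1 hy, lie_neg]
  have hQQ : ∀ x ∈ Q, ∀ y ∈ Q, ⁅x, y⁆ ∈ H := by
    intro x hx y hy
    rw [hH, LieEquiv.map_lie, (hQ x).1 hx, (hQ y).1 hy, lie_neg, neg_lie, neg_neg]
  -- bracket stability of the kernel of the action of `H` on `Q`
  have hker : ∀ x ∈ H, ∀ T ∈ H, (∀ q ∈ Q, ⁅T, q⁆ = 0) → ∀ q ∈ Q, ⁅⁅x, T⁆, q⁆ = 0 := by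
    intro x hx T _ hTq q hq
    rw [lie_lie, hTq q hq, lie_zero, hTq _ (hHQ x hx q hq), sub_zero]
  have hEQ : E ∈ Q := (hQ E).2 hE
  by_cases hfaith : ∀ T ∈ H, (∀ q ∈ Q, ⁅T, q⁆ = 0) → T = 0
  · refine AdSNil.main_aux σ hσ H.toSubmodule Q hH hQ ?_ hfaith E hEQ hnil
    have h1 : Module.finrank ℝ H.toSubmodule = Module.finrank ℝ H := rfl
    rw [h1, hfq, ← dH.trans (by ring : (1 + n) * (1 + n) = (n + 1) * (n + 1))]
    ring
  push Not at hfaith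
  obtain ⟨T, hT, hTq, hT0⟩ := hfaith
  -- the whole of `H` acts trivially on `Q`
  have htriv : ∀ x ∈ H, ∀ q ∈ Q, ⁅x, q⁆ = 0 := by
    rcases Nat.lt_or_ge n 3 with hn3 | hn3
    · have hn2 : n = 2 := by omega
      subst hn2
      let I : LieIdeal ℝ H :=
        { carrier := {x | ∀ q ∈ Q, ⁅(x : L), q⁆ = 0}
          add_mem' := by
            intro a b ha hb q hq
            simp [ha q hq, hb q hq]
          zero_mem' := by intro q _; simp
          smul_mem' := by
            intro c a ha q hq
            simp [ha q hq]
          lie_mem := by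
            intro x m hm q hq
            exact hker x x.2 m m.2 hm q hq }
      rcases AdSNil.ideal_of_equiv eH (by simp) (by simp) I with h | h
      · exfalso
        have hm : (⟨T, hT⟩ : H) ∈ I := hTq
        rw [h, LieSubmodule.mem_bot] at hm
        exact hT0 (congrArg Subtype.val hm)
      · intro x hx
        have hm : (⟨x, hx⟩ : H) ∈ I := by rw [h]; trivial
        exact hm
    · let I : LieIdeal ℝ L :=
        { carrier := {x | x ∈ H ∧ ∀ q ∈ Q, ⁅x, q⁆ = 0}
          add_mem' := by
            rintro a b ⟨ha', ha⟩ ⟨hb', hb⟩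
            refine ⟨H.add_mem ha' hb', fun q hq => ?_⟩
            rw [add_lie, ha q hq, hb q hq, add_zero]
          zero_mem' := ⟨H.zero_mem, fun q _ => zero_lie q⟩
          smul_mem' := by
            rintro c a ⟨ha', ha⟩
            refine ⟨H.smul_mem c ha', fun q hq => ?_⟩
            rw [smul_lie, ha q hq, smul_zero]
          lie_mem := by
            rintro x m ⟨hm', hm⟩
            obtain ⟨h, hh, q, hq, rfl⟩ := hdec x
            have h1 : ⁅q, m⁆ = 0 := by rw [← lie_skew, hm q hq, neg_zero]
            rw [add_lie, h1, add_zero]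
            exact ⟨H.lie_mem hh hm', hker h hh m hm' hm⟩ }
      rcases AdSNil.ideal_of_equiv e
        (by simp only [Fintype.card_sum, Fintype.card_fin]; omega)
        (by simp only [Fintype.card_sum, Fintype.card_fin]; omega) I with h | h
      · exfalso
        have hm : T ∈ I := ⟨hT, hTq⟩
        rw [h, LieSubmodule.mem_bot] at hm
        exact hT0 hm
      · intro x _
        have hm : x ∈ I := by rw [h]; trivial
        exact hm.2
  apply LinearMap.ext
  intro x
  have hcube : ((LieAlgebra.ad ℝ L E) ^ 3) x = ⁅E, ⁅E, ⁅E, x⁆⁆⁆ := rfl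
  have hEH : ∀ y ∈ H, ⁅E, y⁆ = 0 := fun y hy => by
    rw [← lie_skew, htriv y hy E hEQ, neg_zero]
  rw [hcube, LinearMap.zero_apply]
  obtain ⟨h, hh, q, hq, rfl⟩ := hdec x
  rw [lie_add, hEH h hh, zero_add, hEH _ (hQQ E hEQ q hq), lie_zero]
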